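/- For every integer n ≥ 2 and every natural number j ≥ 2, the quantity ⌊S(j)·S(j+2n) / (j·(j+2n))⌋ equals 1 if both j and j+2n are prime, and equals 0 otherwise. -/

import Mathlib

/-- The classical Smarandache function: `S n` is the smallest positive integer `m`
such that `n` divides `m!` (this gives `S 1 = 1`). -/
noncomputable def smarandache (n : ℕ) : ℕ := sInf {m : ℕ | 0 < m ∧ n ∣ Nat.factorial m}

theorem smarandache_le {n m : ℕ} (hm : 0 < m) (h : n ∣ m.factorial) : smarandache n ≤ m :=
  Nat.sInf_le ⟨hm, h⟩

theorem smarandache_le_self {n : ℕ} (hn : 0 < n) : smarandache n ≤ n :=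
  smarandache_le hn (Nat.dvd_factorial hn le_rfl)

theorem smarandache_prime {p : ℕ} (hp : p.Prime) : smarandache p = p := by
  refine le_antisymm (smarandache_le_self hp.pos) ?_
  have h : smarandache p ∈ {m : ℕ | 0 < m ∧ p ∣ m.factorial} :=
    Nat.sInf_mem ⟨p, hp.pos, Nat.dvd_factorial hp.pos le_rfl⟩
  exact hp.dvd_factorial.mp h.2

theorem smarandache_lt_self {n : ℕ} (hn : 2 ≤ n) (hp : ¬ n.Prime) (h4 : n ≠ 4) :
    smarandache n < n := by
  obtain ⟨a, b, ha, hb, rfl⟩ := (Nat.not_prime_iff_exists_mul_eq hn).mp hp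
  have ha2 : 2 ≤ a := by
    by_contra h
    interval_cases a <;> omega
  have hb2 : 2 ≤ b := by
    by_contra h
    interval_cases b <;> omega
  have hdvd : a * b ∣ (a + b).factorial :=
    (mul_dvd_mul (Nat.dvd_factorial (by omega) le_rfl)
      (Nat.dvd_factorial (by omega) le_rfl)).trans (Nat.factorial_mul_factorial_dvd_factorial_add a b)
  refine (smarandache_le (by omega) hdvd).trans_lt ?_
  obtain h | h : 3 ≤ a ∨ 3 ≤ b := by
    by_contra! h
    exact h4 (by rw [show a = 2 by omega, show b = 2 by omega])
  all_goals nlinarith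

theorem prime_pair_indicator (n j : ℕ) (hn : 2 ≤ n) (hj : 2 ≤ j) :
    smarandache j * smarandache (j + 2 * n) / (j * (j + 2 * n))
      = if Nat.Prime j ∧ Nat.Prime (j + 2 * n) then 1 else 0 := by
  split_ifs with h
  · rw [smarandache_prime h.1, smarandache_prime h.2]
    exact Nat.div_self (by positivity)
  · apply Nat.div_eq_of_lt
    by_cases hk : (j + 2 * n).Prime
    · refine Nat.mul_lt_mul_of_lt_of_le (smarandache_lt_self hj (fun hp => h ⟨hp, hk⟩) ?_)
        (smarandache_le_self (by omega)) (by omega)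
      rintro rfl
      have := hk.eq_one_or_self_of_dvd 2 (by omega)
      omega
    · exact Nat.mul_lt_mul_of_le_of_lt (smarandache_le_self (by omega))
        (smarandache_lt_self (by omega) hk (by omega)) (by omega)
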